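/- arXiv:1304.0227 — 2 statements merged into one kernel-verified Lean document; each statement's English description precedes it below -/
import Mathlib

section
/- The topological spaces A₁* and A₂* are homeomorphic. -/
open scoped ZeroAtInfty
open Filter

noncomputable section

variable (K : Type*) [NontriviallyNormedField K] [IsUltrametricDist K] [CompleteSpace K]

/-- The partial sum `x_1 + ⋯ + x_m` of the first `m` coordinates of a sequence. -/
def pSum (x : ℕ → K) (m : ℕ) : K := ∑ j ∈ Finset.range m, x j

/-- The set `A₁`: sequences `x ∈ c₀` with `sup_k |Σ_{j=1}^k x_j| = 1`,
`|1 − Σ_{j=1}^{k+1} x_j| ≤ |1 − Σ_{j=1}^k x_j|` for all `k ≥ 1`, and `Σ_{j=1}^∞ x_j = 1`. -/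
def A1 : Set C₀(ℕ, K) :=
  {x | (⨆ k : ℕ, ‖pSum K (⇑x) (k + 1)‖) = 1 ∧
    (∀ k : ℕ, ‖1 - pSum K (⇑x) (k + 2)‖ ≤ ‖1 - pSum K (⇑x) (k + 1)‖) ∧
    Tendsto (fun m => pSum K (⇑x) m) atTop (nhds 1)}

/-- The set `A₂`: sequences `x ∈ c₀` with `sup_k |Σ_{j=1}^k x_j| = 1`,
`Σ_{j=1}^k x_j ≠ 1` for all `k ≥ 1`, and `Σ_{j=1}^∞ x_j = 1`. -/
def A2 : Set C₀(ℕ, K) :=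
  {x | (⨆ k : ℕ, ‖pSum K (⇑x) (k + 1)‖) = 1 ∧
    (∀ k : ℕ, pSum K (⇑x) (k + 1) ≠ 1) ∧
    Tendsto (fun m => pSum K (⇑x) m) atTop (nhds 1)}

/-- The union `⋃ₙ Eⁿ` of the sets `Eⁿ = {x ∈ c₀ : x_k = 0 ∀ k > n}`:
the eventually-zero sequences. -/
def evZero : Set C₀(ℕ, K) := ⋃ n : ℕ, {x | ∀ k, n ≤ k → x k = 0}

/-- `A₁* = A₁ \ ⋃ₙ Eⁿ`. -/
def A1star : Set C₀(ℕ, K) := A1 K \ evZero K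

/-- `A₂* = A₂ \ ⋃ₙ Eⁿ`. -/
def A2star : Set C₀(ℕ, K) := A2 K \ evZero K

open Set Topology TopologicalSpace

theorem nonempty_homeomorph_nat_fun_of_partitions {X I : Type*} [TopologicalSpace X]
    [IsCompletelyMetrizableSpace X] [Nonempty X] [TopologicalSpace I] [DiscreteTopology I]
    (H : ∀ U : Set X, IsClopen U → U.Nonempty → ∀ V : X → Set X, (∀ x, V x ∈ 𝓝 x) →
      ∃ P : I → Set X, (∀ i, IsClopen (P i) ∧ (P i).Nonempty ∧ ∃ x, P i ⊆ V x) ∧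
        Pairwise (fun i j => Disjoint (P i) (P j)) ∧ ⋃ i, P i = U) :
    Nonempty ((ℕ → I) ≃ₜ X) := by
  let _ := upgradeIsCompletelyMetrizable X
  have H' : ∀ (n : ℕ) (U : {U : Set X // IsClopen U ∧ U.Nonempty}),
      ∃ P : I → {U : Set X // IsClopen U ∧ U.Nonempty},
        (∀ i, Metric.ediam (P i).1 ≤ 2 * (n + 1 : ENNReal)⁻¹) ∧
        Pairwise (fun i j => Disjoint (P i).1 (P j).1) ∧ ⋃ i, (P i).1 = U.1 := by
    rintro n ⟨U, hU, hne⟩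
    obtain ⟨P, hP, hd, hu⟩ := H U hU hne (fun x => Metric.eball x (n + 1 : ENNReal)⁻¹)
      (fun x => Metric.eball_mem_nhds x (by simp [ENNReal.inv_pos]))
    refine ⟨fun i => ⟨P i, (hP i).1, (hP i).2.1⟩, fun i => ?_, hd, hu⟩
    obtain ⟨x, hx⟩ := (hP i).2.2
    exact (Metric.ediam_mono hx).trans Metric.ediam_eball_le
  choose P hdiam hdisj hunion using H'
  let B : List I → {U : Set X // IsClopen U ∧ U.Nonempty} := fun l =>
    List.rec ⟨univ, isClopen_univ, univ_nonempty⟩ (fun i l ih => P l.length ih i) l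
  let A : List I → Set X := fun l => (B l).1
  have hA : ∀ l, ⋃ i, A (i :: l) = A l := fun l => hunion l.length (B l)
  have hanti : CantorScheme.ClosureAntitone A :=
    CantorScheme.Antitone.closureAntitone
      (fun l i => (subset_iUnion (fun i => A (i :: l)) i).trans (hA l).subset)
      (fun l => (B l).2.1.1)
  have hdis : CantorScheme.Disjoint A := fun l => hdisj l.length (B l)
  have hvan : CantorScheme.VanishingDiam A := by
    intro x
    rw [← tendsto_add_atTop_iff_nat 1]
    have h0 : Tendsto (fun n : ℕ => 2 * (n + 1 : ENNReal)⁻¹) atTop (𝓝 0) := by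
      have := ENNReal.Tendsto.const_mul (a := 2)
        ((tendsto_add_atTop_iff_nat 1).2 ENNReal.tendsto_inv_nat_nhds_zero) (Or.inr (by simp))
      simpa using this
    refine tendsto_of_tendsto_of_tendsto_of_le_of_le tendsto_const_nhds h0
      (fun _ => zero_le) (fun n => ?_)
    exact (hdiam (PiNat.res x n).length (B (PiNat.res x n)) (x n)).trans_eq
      (by rw [PiNat.res_length])
  have hdom := hanti.map_of_vanishingDiam hvan (fun l => (B l).2.2)
  let f : (ℕ → I) → X := fun x => (CantorScheme.inducedMap A).2 ⟨x, hdom ▸ mem_univ x⟩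
  have hf : ∀ x n, f x ∈ A (PiNat.res x n) := fun x n => CantorScheme.map_mem _ n
  have hcont : Continuous f := hvan.map_continuous.comp (by fun_prop)
  have hbranch : ∀ (n : ℕ) (x y : ℕ → I), f y ∈ A (PiNat.res x n) →
      PiNat.res y n = PiNat.res x n := by
    intro n x y
    induction n with
    | zero => simp
    | succ n ih =>
      intro h
      have ih := ih (hanti.antitone _ _ h)
      have h2 := hf y (n + 1)
      rw [PiNat.res_succ] at h h2 ⊢
      rw [PiNat.res_succ, ih]
      rw [ih] at h2
      by_contra hne
      have hne' : y n ≠ x n := fun h => hne (by rw [h])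
      exact Set.disjoint_left.1 (hdis _ hne') h2 h
  have hinj : Function.Injective f := fun x y hxy =>
    PiNat.res_injective (funext fun n => hbranch n y x (hxy ▸ hf y n))
  have hsurj : Function.Surjective f := by
    intro p
    have hstep : ∀ l : {l // p ∈ A l}, ∃ i, p ∈ A (i :: l.1) := fun l =>
      mem_iUnion.1 ((hA l.1).symm ▸ l.2)
    choose g hg using hstep
    let L : ℕ → {l // p ∈ A l} := fun n =>
      Nat.rec ⟨[], mem_univ p⟩ (fun _ l => ⟨g l :: l.1, hg l⟩) n
    have hL : ∀ n, PiNat.res (fun n => g (L n)) n = (L n).1 := by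
      intro n
      induction n with
      | zero => rfl
      | succ n ih => rw [PiNat.res_succ, ih]
    refine ⟨fun n => g (L n), ?_⟩
    refine eq_of_forall_dist_le fun ε hε => ?_
    obtain ⟨n, hn⟩ := hvan.dist_lt ε hε (fun n => g (L n))
    exact (hn _ (hf _ n) _ (by rw [hL]; exact (L n).2)).le
  have hopen : IsOpenMap f := by
    intro O hO
    rw [isOpen_iff_mem_nhds]
    rintro _ ⟨x, hx, rfl⟩
    obtain ⟨_, ⟨y, n, rfl⟩, hxy, hsub⟩ :=
      (PiNat.isTopologicalBasis_cylinders fun _ : ℕ => I).exists_subset_of_mem_open hx hO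
    refine mem_of_superset ((B (PiNat.res x n)).2.1.2.mem_nhds (hf x n)) fun p hp => ?_
    obtain ⟨z, rfl⟩ := hsurj p
    refine ⟨z, hsub ?_, rfl⟩
    rw [PiNat.cylinder_eq_res] at hxy ⊢
    exact (hbranch n x z hp).trans hxy
  exact ⟨(Equiv.ofBijective f ⟨hinj, hsurj⟩).toHomeomorphOfContinuousOpen hcont hopen⟩

theorem nonempty_homeomorph_nat_fun_of_isUltrametricDist {X I : Type*} [MetricSpace X]
    [IsUltrametricDist X] [IsCompletelyMetrizableSpace X] [Nonempty X] [Infinite I]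
    [TopologicalSpace I] [DiscreteTopology I]
    (hsmall : ∀ ε > 0, ∃ q : X → I, ∀ x y, q x = q y → dist x y < ε)
    (hlarge : ∀ U : Set X, IsOpen U → U.Nonempty → ∃ p : I → X, (∀ i, p i ∈ U) ∧
      ∀ x, ∃ W ∈ 𝓝 x, ∀ i j, p i ∈ W → p j ∈ W → i = j) :
    Nonempty ((ℕ → I) ≃ₜ X) := by
  classical
  refine nonempty_homeomorph_nat_fun_of_partitions fun U hU hne V hV => ?_
  obtain ⟨p, hpU, hp⟩ := hlarge U hU.2 hne
  choose W hW hWp using hp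
  have hex : ∀ x : U, ∃ n : ℕ, ∃ y, Metric.ball x.1 ((1 / 2) ^ n) ⊆ U ∩ V y ∩ W y := by
    intro x
    obtain ⟨ε, hε, h⟩ := Metric.mem_nhds_iff.1
      (inter_mem (inter_mem (hU.2.mem_nhds x.2) (hV x)) (hW x))
    obtain ⟨n, hn⟩ := exists_pow_lt_of_lt_one hε (by norm_num : (1 / 2 : ℝ) < 1)
    exact ⟨n, x, (Metric.ball_subset_ball hn.le).trans h⟩
  let n : U → ℕ := fun x => Nat.find (hex x)
  let b : U → Set X := fun x => Metric.ball x.1 ((1 / 2) ^ n x)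
  have hb : ∀ x, ∃ y, b x ⊆ U ∩ V y ∩ W y := fun x => Nat.find_spec (hex x)
  have hxb : ∀ x, x.1 ∈ b x := fun x => Metric.mem_ball_self (by positivity)
  have hbU : ∀ x, b x ⊆ U := fun x z hz => by
    obtain ⟨y, hy⟩ := hb x
    exact (hy hz).1.1
  have hmono : ∀ x y : U, y.1 ∈ b x → n y ≤ n x := by
    intro x y hy
    obtain ⟨z, hz⟩ := hb x
    refine Nat.find_min' (hex y) ⟨z, ?_⟩
    rwa [← IsUltrametricDist.ball_eq_of_mem hy]
  have hbeq : ∀ x y : U, y.1 ∈ b x → b y = b x := by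
    intro x y hy
    have h1 := hmono x y hy
    have h2 : x.1 ∈ b y := Metric.ball_subset_ball
      (pow_le_pow_of_le_one (by norm_num) (by norm_num) h1) (Metric.mem_ball_comm.1 hy)
    have h3 : n x = n y := (hmono y x h2).antisymm h1
    have := IsUltrametricDist.ball_eq_of_mem hy
    simp only [b, ← h3, this]
  have hinj : Function.Injective fun i => (⟨b ⟨p i, hpU i⟩, mem_range_self _⟩ : range b) := by
    intro i j hij
    have hij : b ⟨p i, hpU i⟩ = b ⟨p j, hpU j⟩ := congrArg Subtype.val hij
    obtain ⟨y, hy⟩ := hb ⟨p i, hpU i⟩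
    exact hWp y i j (hy (hxb _)).2 (hy (hij ▸ hxb ⟨p j, hpU j⟩)).2
  choose q hq using fun n : ℕ => hsmall ((1 / 2) ^ n) (by positivity)
  choose r hr using fun s : range b => s.2
  have hinj' : Function.Injective fun s : range b => (n (r s), q (n (r s)) (r s)) := by
    intro s t hst
    obtain ⟨h1, h2⟩ := Prod.mk.inj hst
    rw [← h1] at h2
    apply Subtype.ext
    rw [← hr s, ← hr t]
    exact (hbeq (r s) (r t) (Metric.mem_ball'.2 (hq _ _ _ h2))).symm
  have hprod : Nonempty (ℕ × I ≃ I) := by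
    rw [← Cardinal.eq, Cardinal.mk_prod, Cardinal.lift_uzero]
    simp [Cardinal.aleph0_mul_eq]
  obtain ⟨e⟩ := hprod
  obtain ⟨E⟩ := Function.Embedding.antisymm ⟨_, hinj⟩ ⟨_, e.injective.comp hinj'⟩
  refine ⟨fun i => (E i).1, fun i => ?_, fun i j hij => ?_, ?_⟩
  · obtain ⟨x, hx⟩ := (E i).2
    beta_reduce
    rw [← hx]
    obtain ⟨y, hy⟩ := hb x
    exact ⟨IsUltrametricDist.isClopen_ball _ _, ⟨x, hxb x⟩, y, fun z hz => (hy hz).1.2⟩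
  · obtain ⟨x, hx⟩ := (E i).2
    obtain ⟨y, hy⟩ := (E j).2
    rw [Set.disjoint_left]
    intro z hzi hzj
    refine hij (E.injective (Subtype.ext ?_))
    beta_reduce at hzi hzj
    rw [← hx] at hzi ⊢
    rw [← hy] at hzj ⊢
    rw [← hbeq x ⟨z, hbU x hzi⟩ hzi, ← hbeq y ⟨z, hbU x hzi⟩ hzj]
  · apply Subset.antisymm
    · refine iUnion_subset fun i => ?_
      obtain ⟨x, hx⟩ := (E i).2
      rw [← hx]
      exact hbU x
    · intro x hx
      refine mem_iUnion.2 ⟨E.symm ⟨b ⟨x, hx⟩, mem_range_self _⟩, ?_⟩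
      rw [E.apply_symm_apply]
      exact hxb ⟨x, hx⟩

theorem IsUltrametricDist.norm_sub_le_max {E : Type*} [SeminormedAddGroup E] [IsUltrametricDist E]
    (x y : E) : ‖x - y‖ ≤ max ‖x‖ ‖y‖ := by
  rw [sub_eq_add_neg, ← norm_neg y]
  exact norm_add_le_max x (-y)

theorem exists_separated_quotient (K : Type*) [NontriviallyNormedField K] [IsUltrametricDist K] :
    ∃ s : Setoid K, Infinite (Quotient s) ∧
      (∀ i j : Quotient s, i ≠ j → 1 < ‖i.out - j.out‖) ∧
      ∀ x y : K, (Quotient.mk s x) = Quotient.mk s y → ‖x - y‖ ≤ 1 := by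
  let s : Setoid K :=
    { r := fun x y => ‖x - y‖ ≤ 1
      iseqv :=
        { refl := fun x => by simp
          symm := fun {x y} h => by rwa [norm_sub_rev]
          trans := fun {x y z} hxy hyz => by
            rw [← sub_add_sub_cancel x y z]
            exact (IsUltrametricDist.norm_add_le_max _ _).trans (max_le hxy hyz) } }
  refine ⟨s, ?_, fun i j hij => ?_, fun x y h => Quotient.exact h⟩
  · obtain ⟨c, hc⟩ := NormedField.exists_one_lt_norm K
    refine Infinite.of_injective (fun n : ℕ => Quotient.mk s (c ^ (n + 1))) fun m n h => ?_
    have h : ‖c ^ (m + 1) - c ^ (n + 1)‖ ≤ 1 := Quotient.exact h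
    by_contra hmn
    have hne : ‖c ^ (m + 1)‖ ≠ ‖-c ^ (n + 1)‖ := by
      rw [norm_neg, norm_pow, norm_pow]
      exact fun h => hmn (by simpa using pow_right_injective₀ (by linarith) hc.ne' h)
    rw [sub_eq_add_neg, IsUltrametricDist.norm_add_eq_max_of_norm_ne_norm hne, norm_pow] at h
    exact absurd ((le_max_left _ _).trans h) (not_le.2 (one_lt_pow₀ hc (by simp)))
  · by_contra h
    exact hij (by simpa using Quotient.sound (s := s) (not_lt.1 h))

theorem exists_discrete_family_of_separated {K I : Type*} [NontriviallyNormedField K]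
    [IsUltrametricDist K] {c : K} (hc0 : c ≠ 0) (hc1 : ‖c‖ < 1) {s : I → K}
    (hs : ∀ i j, i ≠ j → 1 < ‖s i - s j‖) {r : ℝ} (hr : 0 < r) :
    ∃ p : I → K, (∀ i, p i ≠ 0 ∧ ‖p i‖ ≤ r) ∧
      ∀ x, x ≠ 0 → ∃ δ > 0, ∀ i j, ‖p i - x‖ < δ → ‖p j - x‖ < δ → i = j := by
  have hc : 0 < ‖c‖ := norm_pos_iff.2 hc0
  obtain ⟨M, hM⟩ := exists_pow_lt_of_lt_one hr hc1
  have hex : ∀ i, ∃ n, M ≤ n ∧ ‖c ^ n * s i‖ ≤ 1 := by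
    intro i
    obtain ⟨m, hm⟩ := exists_pow_lt_of_lt_one (y := ‖c‖) (x := 1 / (‖s i‖ + 1))
      (by positivity) hc1
    refine ⟨max m M, le_max_right _ _, ?_⟩
    have h1 : ‖c‖ ^ max m M ≤ ‖c‖ ^ m := pow_le_pow_of_le_one hc.le hc1.le (le_max_left _ _)
    have h2 : 0 < ‖s i‖ + 1 := by positivity
    rw [norm_mul, norm_pow]
    calc ‖c‖ ^ max m M * ‖s i‖ ≤ 1 / (‖s i‖ + 1) * (‖s i‖ + 1) := by
          gcongr
          · exact h1.trans hm.le
          · linarith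
      _ = 1 := by field_simp
  choose n hMn hn using hex
  have hnorm : ∀ i, ‖c ^ n i + c ^ (2 * n i + 1) * s i‖ = ‖c‖ ^ n i := by
    intro i
    have hlt : ‖c ^ (2 * n i + 1) * s i‖ < ‖c ^ n i‖ := by
      have : c ^ (2 * n i + 1) * s i = c ^ n i * (c * (c ^ n i * s i)) := by ring
      rw [this, norm_mul, norm_mul c]
      have hpos : 0 < ‖c ^ n i‖ := norm_pos_iff.2 (pow_ne_zero _ hc0)
      have : ‖c‖ * ‖c ^ n i * s i‖ < 1 := by nlinarith [hn i]
      nlinarith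
    rw [IsUltrametricDist.norm_add_eq_max_of_norm_ne_norm hlt.ne', max_eq_left hlt.le, norm_pow]
  refine ⟨fun i => c ^ n i + c ^ (2 * n i + 1) * s i, fun i => ⟨?_, ?_⟩, fun x hx => ?_⟩
  · rw [← norm_pos_iff, hnorm]
    positivity
  · rw [hnorm]
    exact (pow_le_pow_of_le_one hc.le hc1.le (hMn i)).trans hM.le
  · have hx' : 0 < ‖x‖ := norm_pos_iff.2 hx
    refine ⟨min ‖x‖ (‖c‖ * ‖x‖ ^ 2), by positivity, fun i j hi hj => ?_⟩
    have key : ∀ i, ‖c ^ n i + c ^ (2 * n i + 1) * s i - x‖ < ‖x‖ → ‖c‖ ^ n i = ‖x‖ := by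
      intro i h
      rw [← hnorm]
      by_contra hne
      rw [sub_eq_add_neg, IsUltrametricDist.norm_add_eq_max_of_norm_ne_norm
        (by rwa [norm_neg]), norm_neg] at h
      exact absurd (le_max_right _ _) (not_le.2 h)
    have h1 := key i (hi.trans_le (min_le_left _ _))
    have h2 := key j (hj.trans_le (min_le_left _ _))
    have h3 : n i = n j := pow_right_injective₀ hc hc1.ne (h1.trans h2.symm)
    by_contra hij
    have h4 := (IsUltrametricDist.norm_sub_le_max
      (c ^ n i + c ^ (2 * n i + 1) * s i - x) (c ^ n j + c ^ (2 * n j + 1) * s j - x)).trans_lt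
      (max_lt (hi.trans_le (min_le_right _ _)) (hj.trans_le (min_le_right _ _)))
    have h5 : c ^ n i + c ^ (2 * n i + 1) * s i - x - (c ^ n j + c ^ (2 * n j + 1) * s j - x) =
        c ^ (2 * n i + 1) * (s i - s j) := by
      rw [← h3]
      ring
    rw [h5, norm_mul, norm_pow, ← h1] at h4
    have h6 : ‖c‖ * (‖c‖ ^ n i) ^ 2 = ‖c‖ ^ (2 * n i + 1) := by ring
    rw [h6] at h4
    have h7 : 0 < ‖c‖ ^ (2 * n i + 1) := by positivity
    nlinarith [hs i j hij]

namespace ZeroAtInftyContinuousMap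

theorem dist_le_iff_of_nonneg {K : Type*} [SeminormedAddCommGroup K] {u v : C₀(ℕ, K)} {C : ℝ}
    (hC : 0 ≤ C) : dist u v ≤ C ↔ ∀ k, ‖u k - v k‖ ≤ C := by
  simp_rw [← dist_eq_norm]
  exact BoundedContinuousFunction.dist_le hC

theorem norm_sub_apply_le_dist {K : Type*} [SeminormedAddCommGroup K] (u v : C₀(ℕ, K)) (k : ℕ) :
    ‖u k - v k‖ ≤ dist u v :=
  (dist_le_iff_of_nonneg dist_nonneg).1 le_rfl k

theorem tendsto_atTop_nat {K : Type*} [TopologicalSpace K] [Zero K] (u : C₀(ℕ, K)) :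
    Tendsto u atTop (𝓝 0) :=
  cocompact_eq_atTop (α := ℕ) ▸ zero_at_infty u

theorem continuous_apply_nat {K : Type*} [SeminormedAddCommGroup K] (k : ℕ) :
    Continuous fun u : C₀(ℕ, K) => u k :=
  (LipschitzWith.of_dist_le_mul (K := 1) fun u v => by
    simpa [dist_eq_norm (u k)] using norm_sub_apply_le_dist u v k).continuous

/-- A null sequence as an element of `C₀(ℕ, K)`. -/
def ofTendstoNat {K : Type*} [TopologicalSpace K] [Zero K] (u : ℕ → K)
    (hu : Tendsto u atTop (𝓝 0)) : C₀(ℕ, K) :=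
  ⟨⟨u, continuous_of_discreteTopology⟩, by simpa [cocompact_eq_atTop] using hu⟩

@[simp]
theorem ofTendstoNat_apply {K : Type*} [TopologicalSpace K] [Zero K] (u : ℕ → K)
    (hu : Tendsto u atTop (𝓝 0)) (k : ℕ) : ofTendstoNat u hu k = u k := rfl

instance isUltrametricDist {K : Type*} [SeminormedAddCommGroup K] [IsUltrametricDist K] :
    IsUltrametricDist C₀(ℕ, K) where
  dist_triangle_max u v w := by
    rw [dist_le_iff_of_nonneg (le_max_of_le_left dist_nonneg)]
    intro k
    rw [← sub_add_sub_cancel _ (v k)]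
    exact (IsUltrametricDist.norm_add_le_max _ _).trans
      (max_le_max (norm_sub_apply_le_dist u v k) (norm_sub_apply_le_dist v w k))

end ZeroAtInftyContinuousMap

open ZeroAtInftyContinuousMap

theorem exists_fibers_dist_lt {K I : Type*} [NontriviallyNormedField K] [IsUltrametricDist K]
    [Infinite I] {π : K → I} (hπ : ∀ x y, π x = π y → ‖x - y‖ ≤ 1) {ε : ℝ} (hε : 0 < ε) :
    ∃ q : C₀(ℕ, K) → I, ∀ u v, q u = q v → dist u v < ε := by
  obtain ⟨a, ha0, ha⟩ := NormedField.exists_norm_lt K hε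
  have ha0' := norm_pos_iff.1 ha0
  have hN : ∀ u : C₀(ℕ, K), ∃ N, ∀ k ≥ N, ‖u k‖ ≤ ‖a‖ := by
    intro u
    have := (tendsto_zero_iff_norm_tendsto_zero.1 (tendsto_atTop_nat u)).eventually_le_const ha0
    exact eventually_atTop.1 this
  choose N hN using hN
  obtain ⟨e⟩ : Nonempty (List I ≃ I) := by
    rw [← Cardinal.eq, Cardinal.mk_list_eq_mk]
  refine ⟨fun u => e ((List.range (N u)).map fun k => π (a⁻¹ * u k)), fun u v h => ?_⟩
  have h := e.injective h
  have hlen : N u = N v := by simpa using congrArg List.length h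
  refine lt_of_le_of_lt ((dist_le_iff_of_nonneg ha0.le).2 fun k => ?_) ha
  by_cases hk : k < N u
  · rw [← hlen, List.map_inj_left] at h
    have := hπ _ _ (h k (List.mem_range.2 hk))
    rw [← mul_sub, norm_mul, norm_inv, inv_mul_le_iff₀ ha0, mul_one] at this
    exact this
  · exact (IsUltrametricDist.norm_sub_le_max _ _).trans
      (max_le (hN u k (not_lt.1 hk)) (hN v k (hlen ▸ not_lt.1 hk)))

/-- The sequence `(u₀, …, u_{N-1}, x, x c, x c², …)`. -/
def spliceGeometric {K : Type*} [NormedField K] {c : K} (hc : ‖c‖ < 1) (u : ℕ → K) (N : ℕ)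
    (x : K) : C₀(ℕ, K) :=
  ofTendstoNat (fun k => if k < N then u k else x * c ^ (k - N)) <| by
    rw [← tendsto_add_atTop_iff_nat N]
    simpa using (tendsto_pow_atTop_nhds_zero_of_norm_lt_one hc).const_mul x

theorem spliceGeometric_of_lt {K : Type*} [NormedField K] {c : K} (hc : ‖c‖ < 1) (u : ℕ → K)
    {N k : ℕ} (x : K) (hk : k < N) : spliceGeometric hc u N x k = u k :=
  if_pos hk

theorem spliceGeometric_of_le {K : Type*} [NormedField K] {c : K} (hc : ‖c‖ < 1) (u : ℕ → K)
    {N k : ℕ} (x : K) (hk : N ≤ k) : spliceGeometric hc u N x k = x * c ^ (k - N) :=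
  if_neg (not_lt.2 hk)

theorem norm_spliceGeometric_le {K : Type*} [NormedField K] {c : K} (hc : ‖c‖ < 1) (u : ℕ → K)
    {N k : ℕ} (x : K) (hk : N ≤ k) : ‖spliceGeometric hc u N x k‖ ≤ ‖x‖ := by
  rw [spliceGeometric_of_le hc u x hk, norm_mul, norm_pow]
  exact mul_le_of_le_one_right (norm_nonneg _) (pow_le_one₀ (norm_nonneg _) hc.le)

theorem spliceGeometric_ne_zero {K : Type*} [NormedField K] {c : K} (hc : ‖c‖ < 1) (hc0 : c ≠ 0)
    {u : ℕ → K} {N : ℕ} {x : K} (hu : ∀ k < N, u k ≠ 0) (hx : x ≠ 0) (k : ℕ) :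
    spliceGeometric hc u N x k ≠ 0 := by
  rcases lt_or_ge k N with h | h
  · rw [spliceGeometric_of_lt hc u x h]
    exact hu k h
  · rw [spliceGeometric_of_le hc u x h]
    exact mul_ne_zero hx (pow_ne_zero _ hc0)

theorem isCompletelyMetrizableSpace_setOf_ne_zero {K : Type*} [NormedField K] [CompleteSpace K]
    {F : Set C₀(ℕ, K)} (hF : IsClosed F) :
    IsCompletelyMetrizableSpace {u | u ∈ F ∧ ∀ k, u k ≠ 0} := by
  let f : {u | u ∈ F ∧ ∀ k, u k ≠ 0} → C₀(ℕ, K) × (ℕ → K) := fun u => (u.1, fun k => (u.1 k)⁻¹)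
  have hcont : Continuous f := continuous_subtype_val.prodMk <| continuous_pi fun k =>
    ((continuous_apply_nat k).comp continuous_subtype_val).inv₀ fun u => u.2.2 k
  have hind : IsEmbedding f :=
    IsEmbedding.of_comp hcont continuous_fst IsEmbedding.subtypeVal
  refine IsClosedEmbedding.IsCompletelyMetrizableSpace (f := f) ⟨hind, ?_⟩
  have hrange : range f = {p | p.1 ∈ F} ∩ ⋂ k, {p | p.1 k * p.2 k = 1} := by
    ext ⟨u, v⟩
    simp only [mem_range, mem_inter_iff, mem_iInter, mem_ofPred_eq]
    constructor
    · rintro ⟨w, hw⟩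
      obtain ⟨rfl, rfl⟩ := Prod.mk.inj hw
      exact ⟨w.2.1, fun k => mul_inv_cancel₀ (w.2.2 k)⟩
    · rintro ⟨hu, huv⟩
      refine ⟨⟨u, hu, fun k => left_ne_zero_of_mul_eq_one (huv k)⟩, ?_⟩
      exact Prod.ext rfl (funext fun k => (eq_inv_of_mul_eq_one_right (huv k)).symm)
  rw [hrange]
  exact (hF.preimage continuous_fst).inter <| isClosed_iInter fun k =>
    isClosed_eq (((continuous_apply_nat k).comp continuous_fst).mul
      ((continuous_apply k).comp continuous_snd)) continuous_const

theorem nonempty_homeomorph_of_spliceGeometric_mem {K I : Type*} [NontriviallyNormedField K]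
    [IsUltrametricDist K] [CompleteSpace K] [Infinite I] [TopologicalSpace I] [DiscreteTopology I]
    {s : I → K} (hs : ∀ i j, i ≠ j → 1 < ‖s i - s j‖) {π : K → I}
    (hπ : ∀ x y, π x = π y → ‖x - y‖ ≤ 1) {c : K} (hc0 : c ≠ 0) (hc : ‖c‖ < 1)
    {F : Set C₀(ℕ, K)} (hF : IsClosed F) (hne : ∃ u ∈ F, ∀ k, u k ≠ 0)
    (hsplice : ∀ u ∈ F, ∀ N x, ‖x‖ ≤ ‖u N‖ → spliceGeometric hc u N x ∈ F) :
    Nonempty ((ℕ → I) ≃ₜ {u | u ∈ F ∧ ∀ k, u k ≠ 0}) := by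
  have := isCompletelyMetrizableSpace_setOf_ne_zero hF
  have : Nonempty {u | u ∈ F ∧ ∀ k, u k ≠ 0} := let ⟨u, hu⟩ := hne; ⟨⟨u, hu⟩⟩
  refine nonempty_homeomorph_nat_fun_of_isUltrametricDist (fun ε hε => ?_) fun U hU hUne => ?_
  · obtain ⟨q, hq⟩ := exists_fibers_dist_lt hπ hε
    exact ⟨fun u => q u.1, fun u v h => hq _ _ h⟩
  · obtain ⟨u, hu⟩ := hUne
    obtain ⟨ε, hε, hball⟩ := Metric.isOpen_iff.1 hU u hu
    obtain ⟨N, hN⟩ := eventually_atTop.1 ((tendsto_zero_iff_norm_tendsto_zero.1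
      (tendsto_atTop_nat u.1)).eventually_le_const (half_pos hε))
    obtain ⟨p, hp, hpd⟩ := exists_discrete_family_of_separated hc0 hc hs
      (norm_pos_iff.2 (u.2.2 N))
    refine ⟨fun i => ⟨spliceGeometric hc u.1 N (p i), hsplice _ u.2.1 N _ (hp i).2,
      spliceGeometric_ne_zero hc hc0 (fun k _ => u.2.2 k) (hp i).1⟩, fun i => hball ?_,
      fun x => ?_⟩
    · refine lt_of_le_of_lt ((dist_le_iff_of_nonneg (half_pos hε).le).2 fun k => ?_)
        (half_lt_self hε)
      rcases lt_or_ge k N with h | h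
      · rw [spliceGeometric_of_lt _ _ _ h, sub_self, norm_zero]
        exact (half_pos hε).le
      · exact (IsUltrametricDist.norm_sub_le_max _ _).trans (max_le
          ((norm_spliceGeometric_le hc _ _ h).trans ((hp i).2.trans (hN N le_rfl))) (hN k h))
    · obtain ⟨δ, hδ, hinj⟩ := hpd (x.1 N) (x.2.2 N)
      refine ⟨Metric.ball x δ, Metric.ball_mem_nhds x hδ, fun i j hi hj => hinj i j ?_ ?_⟩
      · have := (norm_sub_apply_le_dist _ _ N).trans_lt hi
        simpa [spliceGeometric_of_le] using this
      · have := (norm_sub_apply_le_dist _ _ N).trans_lt hj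
        simpa [spliceGeometric_of_le] using this

/-- The null sequence whose partial sums are `1 - u₀, 1 - u₁, …`. -/
def ofRemainders {K : Type*} [NormedField K] (u : C₀(ℕ, K)) : C₀(ℕ, K) :=
  ofTendstoNat (fun k => Nat.casesOn k (1 - u 0) fun k => u k - u (k + 1)) <| by
    rw [← tendsto_add_atTop_iff_nat 1]
    have h := tendsto_atTop_nat u
    simpa using h.sub ((tendsto_add_atTop_iff_nat 1).2 h)

section Remainders

variable {K : Type*} [NontriviallyNormedField K]

@[simp]
theorem ofRemainders_zero (u : C₀(ℕ, K)) : ofRemainders u 0 = 1 - u 0 := rfl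

@[simp]
theorem ofRemainders_succ (u : C₀(ℕ, K)) (k : ℕ) :
    ofRemainders u (k + 1) = u k - u (k + 1) := rfl

theorem sum_range_succ_ofRemainders (u : C₀(ℕ, K)) (m : ℕ) :
    ∑ j ∈ Finset.range (m + 1), ofRemainders u j = 1 - u m := by
  induction m with
  | zero => simp
  | succ m ih => rw [Finset.sum_range_succ, ih, ofRemainders_succ]; ring

theorem isometry_ofRemainders [IsUltrametricDist K] :
    Isometry (ofRemainders : C₀(ℕ, K) → C₀(ℕ, K)) := by
  refine Isometry.of_dist_eq fun u v => le_antisymm ?_ ?_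
  · refine (dist_le_iff_of_nonneg dist_nonneg).2 fun k => ?_
    cases k with
    | zero =>
      rw [ofRemainders_zero, ofRemainders_zero, sub_sub_sub_cancel_left, norm_sub_rev]
      exact norm_sub_apply_le_dist u v 0
    | succ k =>
      rw [ofRemainders_succ, ofRemainders_succ, sub_sub_sub_comm]
      exact (IsUltrametricDist.norm_sub_le_max _ _).trans
        (max_le (norm_sub_apply_le_dist u v k) (norm_sub_apply_le_dist u v (k + 1)))
  · refine (dist_le_iff_of_nonneg dist_nonneg).2 fun k => ?_
    have h : v k - u k = ∑ j ∈ Finset.range (k + 1), (ofRemainders u j - ofRemainders v j) := by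
      rw [Finset.sum_sub_distrib, sum_range_succ_ofRemainders, sum_range_succ_ofRemainders]
      ring
    rw [norm_sub_rev, h]
    exact IsUltrametricDist.norm_sum_le_of_forall_le_of_nonneg dist_nonneg
      fun j _ => norm_sub_apply_le_dist _ _ j

theorem pSum_ofRemainders (u : C₀(ℕ, K)) (m : ℕ) :
    pSum K (ofRemainders u) (m + 1) = 1 - u m :=
  sum_range_succ_ofRemainders u m

theorem tendsto_pSum_ofRemainders (u : C₀(ℕ, K)) :
    Tendsto (fun m => pSum K (ofRemainders u) m) atTop (𝓝 1) := by
  rw [← tendsto_add_atTop_iff_nat 1]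
  simpa [pSum_ofRemainders] using (tendsto_atTop_nat u).const_sub 1

theorem exists_ofRemainders_eq {x : C₀(ℕ, K)}
    (hx : Tendsto (fun m => pSum K x m) atTop (𝓝 1)) : ∃ u, ofRemainders u = x := by
  refine ⟨ofTendstoNat (fun k => 1 - pSum K x (k + 1)) ?_, ?_⟩
  · simpa using ((tendsto_add_atTop_iff_nat 1).2 hx).const_sub 1
  · ext k
    cases k with
    | zero => simp [pSum]
    | succ k => simp [pSum, Finset.sum_range_succ _ (k + 1)]

theorem iSup_norm_one_sub_eq_one_iff [IsUltrametricDist K] (u : C₀(ℕ, K)) :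
    ⨆ k, ‖1 - u k‖ = 1 ↔ ∀ k, ‖u k‖ ≤ 1 := by
  have hlim : Tendsto (fun k => ‖1 - u k‖) atTop (𝓝 1) := by
    simpa using ((tendsto_atTop_nat u).const_sub 1).norm
  have hle : ∀ y : K, ‖y‖ ≤ 1 → ‖1 - y‖ ≤ 1 := fun y hy =>
    (IsUltrametricDist.norm_sub_le_max _ _).trans (max_le norm_one.le hy)
  constructor
  · intro h k
    have := hle (1 - u k) ((le_ciSup hlim.bddAbove_range k).trans h.le)
    rwa [sub_sub_cancel] at this
  · intro h
    exact le_antisymm (ciSup_le fun k => hle _ (h k))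
      (le_of_tendsto' hlim fun k => le_ciSup hlim.bddAbove_range k)

theorem ofRemainders_mem_evZero_iff (u : C₀(ℕ, K)) :
    ofRemainders u ∈ evZero K ↔ ∃ n, ∀ k, n ≤ k → u k = 0 := by
  simp only [evZero, mem_iUnion, mem_ofPred_eq]
  constructor
  · rintro ⟨n, hn⟩
    have hconst : ∀ k, n ≤ k → u k = u n := fun k hk => by
      induction k, hk using Nat.le_induction with
      | base => rfl
      | succ k hk ih =>
        rw [← ih]
        exact (sub_eq_zero.1 (hn (k + 1) (by omega))).symm
    have h0 : u n = 0 := tendsto_nhds_unique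
      (tendsto_const_nhds.congr' (eventually_atTop.2 ⟨n, fun k hk => (hconst k hk).symm⟩))
      (tendsto_atTop_nat u)
    exact ⟨n, fun k hk => (hconst k hk).trans h0⟩
  · rintro ⟨n, hn⟩
    refine ⟨n + 1, fun k hk => ?_⟩
    obtain ⟨k, rfl⟩ : ∃ j, k = j + 1 := ⟨k - 1, by omega⟩
    rw [ofRemainders_succ, hn k (by omega), hn (k + 1) (by omega), sub_zero]

theorem A1star_eq_image [IsUltrametricDist K] : A1star K = Set.image ofRemainders
    {u | u ∈ {u : C₀(ℕ, K) | (∀ k, ‖u k‖ ≤ 1) ∧ ∀ k, ‖u (k + 1)‖ ≤ ‖u k‖} ∧ ∀ k, u k ≠ 0} := by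
  ext x
  constructor
  · rintro ⟨⟨h1, h2, h3⟩, h4⟩
    obtain ⟨u, rfl⟩ := exists_ofRemainders_eq h3
    simp only [pSum_ofRemainders, sub_sub_cancel] at h1 h2
    refine ⟨u, ⟨⟨(iSup_norm_one_sub_eq_one_iff u).1 h1, h2⟩, fun k hk => h4 ?_⟩, rfl⟩
    refine (ofRemainders_mem_evZero_iff u).2 ⟨k, fun j hj => norm_le_zero_iff.1 ?_⟩
    exact (antitone_nat_of_succ_le (f := fun k => ‖u k‖) h2 hj).trans (by simp [hk])
  · rintro ⟨u, ⟨⟨h1, h2⟩, h3⟩, rfl⟩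
    refine ⟨⟨?_, ?_, tendsto_pSum_ofRemainders u⟩, fun h => ?_⟩
    · simpa only [pSum_ofRemainders] using (iSup_norm_one_sub_eq_one_iff u).2 h1
    · simpa only [pSum_ofRemainders, sub_sub_cancel] using h2
    · obtain ⟨n, hn⟩ := (ofRemainders_mem_evZero_iff u).1 h
      exact h3 n (hn n le_rfl)

theorem A2star_eq_image [IsUltrametricDist K] : A2star K = Set.image ofRemainders
    {u | u ∈ {u : C₀(ℕ, K) | ∀ k, ‖u k‖ ≤ 1} ∧ ∀ k, u k ≠ 0} := by
  ext x
  constructor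
  · rintro ⟨⟨h1, h2, h3⟩, -⟩
    obtain ⟨u, rfl⟩ := exists_ofRemainders_eq h3
    simp only [pSum_ofRemainders, ne_eq, sub_eq_self] at h1 h2
    exact ⟨u, ⟨(iSup_norm_one_sub_eq_one_iff u).1 h1, h2⟩, rfl⟩
  · rintro ⟨u, ⟨h1, h3⟩, rfl⟩
    refine ⟨⟨?_, ?_, tendsto_pSum_ofRemainders u⟩, fun h => ?_⟩
    · simpa only [pSum_ofRemainders] using (iSup_norm_one_sub_eq_one_iff u).2 h1
    · simpa only [pSum_ofRemainders, ne_eq, sub_eq_self] using h3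
    · obtain ⟨n, hn⟩ := (ofRemainders_mem_evZero_iff u).1 h
      exact h3 n (hn n le_rfl)

end Remainders

/-- The topological spaces `A₁*` and `A₂*` (with the topology inherited
from `c₀`) are homeomorphic. -/
theorem A1star_homeomorph_A2star : Nonempty (↥(A1star K) ≃ₜ ↥(A2star K)) := by
  obtain ⟨c, hc0, hc⟩ := NormedField.exists_norm_lt_one K
  have hc0 : c ≠ 0 := norm_pos_iff.1 hc0
  obtain ⟨s, hinf, hs, hπ⟩ := exists_separated_quotient K
  let _ : TopologicalSpace (Quotient s) := ⊥
  have : DiscreteTopology (Quotient s) := ⟨rfl⟩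
  have hgeom : ∀ k, spliceGeometric hc 0 0 1 k = c ^ k := fun k => by
    rw [spliceGeometric_of_le hc 0 1 k.zero_le, one_mul, Nat.sub_zero]
  have hpow : ∀ k, ‖c ^ k‖ ≤ 1 := fun k => by
    rw [norm_pow]
    exact pow_le_one₀ (norm_nonneg _) hc.le
  have hpow' : ∀ (x : K) k, ‖x * c ^ (k + 1)‖ ≤ ‖x * c ^ k‖ := fun x k => by
    rw [pow_succ, ← mul_assoc, norm_mul _ c]
    exact mul_le_of_le_one_right (norm_nonneg _) hc.le
  have hsplice : ∀ (u : C₀(ℕ, K)), (∀ k, ‖u k‖ ≤ 1) → ∀ N x, ‖x‖ ≤ ‖u N‖ →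
      ∀ k, ‖spliceGeometric hc u N x k‖ ≤ 1 := by
    intro u hu N x hx k
    rcases lt_or_ge k N with h | h
    · rw [spliceGeometric_of_lt hc u x h]
      exact hu k
    · exact (norm_spliceGeometric_le hc u x h).trans (hx.trans (hu N))
  have hF : IsClosed {u : C₀(ℕ, K) | ∀ k, ‖u k‖ ≤ 1} := by
    simp only [ofPred_forall]
    exact isClosed_iInter fun k => isClosed_le (continuous_apply_nat k).norm continuous_const
  have hF' : IsClosed {u : C₀(ℕ, K) | ∀ k, ‖u (k + 1)‖ ≤ ‖u k‖} := by
    simp only [ofPred_forall]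
    exact isClosed_iInter fun k =>
      isClosed_le (continuous_apply_nat (k + 1)).norm (continuous_apply_nat k).norm
  obtain ⟨e₁⟩ := nonempty_homeomorph_of_spliceGeometric_mem hs hπ hc0 hc (hF.inter hF')
    ⟨spliceGeometric hc 0 0 1, ⟨fun k => (hgeom k).symm ▸ hpow k, fun k => by
      simpa only [hgeom, one_mul] using hpow' 1 k⟩,
      fun k => (hgeom k).symm ▸ pow_ne_zero k hc0⟩
    (by
      rintro u ⟨hu, hu'⟩ N x hx
      refine ⟨hsplice u hu N x hx, fun k => ?_⟩
      rcases lt_trichotomy (k + 1) N with h | h | h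
      · rw [spliceGeometric_of_lt hc u x h, spliceGeometric_of_lt hc u x (by omega)]
        exact hu' k
      · rw [spliceGeometric_of_lt hc u x (show k < N by omega)]
        exact (norm_spliceGeometric_le hc u x h.ge).trans (hx.trans (h ▸ hu' k))
      · rw [spliceGeometric_of_le hc u x h.le, spliceGeometric_of_le hc u x (by omega : N ≤ k),
          Nat.succ_sub (by omega : N ≤ k)]
        exact hpow' x _)
  obtain ⟨e₂⟩ := nonempty_homeomorph_of_spliceGeometric_mem hs hπ hc0 hc hF
    ⟨spliceGeometric hc 0 0 1, fun k => (hgeom k).symm ▸ hpow k,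
      fun k => (hgeom k).symm ▸ pow_ne_zero k hc0⟩ hsplice
  have hemb := (isometry_ofRemainders (K := K)).isEmbedding
  rw [A1star_eq_image, A2star_eq_image]
  exact ⟨(hemb.homeomorphImage _).symm.trans
    (e₁.symm.trans (e₂.trans (hemb.homeomorphImage _)))⟩

end
end

section
/- Let X be either K^ℕ with the Tychonoff product topology or c₀(ℕ,K) with its norm topology, and let {T_j : j ∈ ℕ} be a countable family of compact subsets of X. Then there exists a homeomorphism g of X onto X such that g(T_j) is infinitely deficient for every j ∈ ℕ. -/
open scoped ZeroAtInfty

/-- A subset `E` of `K^ℕ` is infinitely deficient if there is an infinite set `β ⊆ ℕ`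
such that the `j`-th coordinate projection maps `E` to a single point for every `j ∈ β`. -/
def InfinitelyDeficientPi {K : Type*} [NontriviallyNormedField K] (E : Set (ℕ → K)) : Prop :=
  ∃ β : Set ℕ, β.Infinite ∧ ∀ j ∈ β, ∃ c : K, ∀ x ∈ E, x j = c

/-- A subset `E` of `c₀(ℕ, K)` is infinitely deficient if there is an infinite set
`β ⊆ ℕ` such that the `j`-th coordinate projection maps `E` to a single point for every
`j ∈ β`. -/
def InfinitelyDeficientC0 {K : Type*} [NontriviallyNormedField K] (E : Set C₀(ℕ, K)) : Prop :=
  ∃ β : Set ℕ, β.Infinite ∧ ∀ j ∈ β, ∃ c : K, ∀ x ∈ E, x j = c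

section

open Set Filter Topology TopologicalSpace PiNat

/-- A sequence of pairwise disjoint nonempty clopen sets of diameter at most `ε` with union `A`. -/
structure IsClopenPartition {X : Type*} [PseudoEMetricSpace X] (a : ℕ → Set X) (A : Set X)
    (ε : ENNReal) : Prop where
  isClopen : ∀ i, IsClopen (a i)
  nonempty : ∀ i, (a i).Nonempty
  ediam_le : ∀ i, Metric.ediam (a i) ≤ ε
  disjoint : Pairwise fun i j => Disjoint (a i) (a j)
  iUnion_eq : ⋃ i, a i = A

theorem IsClopenPartition.comp_bijective {X : Type*} [PseudoEMetricSpace X] {a : ℕ → Set X}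
    {A : Set X} {ε : ENNReal} (h : IsClopenPartition a A ε) {σ : ℕ → ℕ}
    (hσ : Function.Bijective σ) : IsClopenPartition (a ∘ σ) A ε where
  isClopen i := h.isClopen _
  nonempty i := h.nonempty _
  ediam_le i := h.ediam_le _
  disjoint _ _ hij := h.disjoint (hσ.injective.ne hij)
  iUnion_eq := by
    rw [← h.iUnion_eq]
    exact hσ.surjective.iUnion_comp a

/-- If the `d i` are pairwise disjoint clopen sets and infinitely many of them meet `C`, then the
empty ones can be discarded. -/
theorem IsClopenPartition.exists_of_infinite {X : Type*} [PseudoEMetricSpace X] {d : ℕ → Set X}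
    {A C : Set X} {ε : ENNReal} (hclopen : ∀ i, IsClopen (d i)) (hdiam : ∀ i, Metric.ediam (d i) ≤ ε)
    (hdisj : Pairwise fun i j => Disjoint (d i) (d j)) (hU : ⋃ i, d i = A)
    (hinf : {i | (C ∩ d i).Nonempty}.Infinite) :
    ∃ a : ℕ → Set X, IsClopenPartition a A ε ∧ {i | (C ∩ a i).Nonempty}.Infinite := by
  have hI : {i | (d i).Nonempty}.Infinite := hinf.mono fun i hi => hi.mono inter_subset_right
  have hmem : ∀ i, (d (Nat.nth (fun i => (d i).Nonempty) i)).Nonempty := fun i =>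
    Nat.nth_mem_of_infinite hI i
  have hinj := Nat.nth_injective hI
  have hrange := Nat.range_nth_of_infinite hI
  refine ⟨fun i => d (Nat.nth (fun i => (d i).Nonempty) i),
    ⟨fun i => hclopen _, hmem, fun i => hdiam _, fun i j hij => hdisj (hinj.ne hij), ?_⟩, ?_⟩
  · rw [← hU]
    refine subset_antisymm (iUnion_subset fun i => subset_iUnion d _) (iUnion_subset fun i x hx => ?_)
    have : i ∈ range (Nat.nth fun i => (d i).Nonempty) := by
      rw [hrange]; exact ⟨x, hx⟩
    obtain ⟨k, rfl⟩ := this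
    exact mem_iUnion_of_mem k hx
  · refine Infinite.preimage (s := {i | (C ∩ d i).Nonempty}) hinf ?_
    rw [hrange]
    exact fun i hi => hi.mono inter_subset_right

theorem exists_isClopenPartition_infinite {X : Type*} [PseudoEMetricSpace X]
    [SecondCountableTopology X]
    (hz : IsTopologicalBasis {s : Set X | IsClopen s}) {A C : Set X} (hA : IsClopen A)
    (hC : IsClosed C) (hCA : C ⊆ A) (hnc : ¬ IsCompact C) {ε : ENNReal} (hε : 0 < ε) :
    ∃ a : ℕ → Set X, IsClopenPartition a A ε ∧ {i | (C ∩ a i).Nonempty}.Infinite := by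
  rw [isCompact_iff_finite_subcover] at hnc
  push Not at hnc
  obtain ⟨ι, U, hUo, hCU, hfin⟩ := hnc
  have hCne : C.Nonempty := by
    by_contra h
    exact hfin ∅ (by simp [not_nonempty_iff_eq_empty.mp h])
  obtain ⟨x₀, hx₀⟩ := hCne
  obtain ⟨i₀, -⟩ := mem_iUnion.mp (hCU hx₀)
  have key : ∀ x, ∃ V : Set X, x ∈ A →
      IsClopen V ∧ x ∈ V ∧ V ⊆ A ∧ Metric.ediam V ≤ ε ∧ ∃ i, C ∩ V ⊆ U i := by
    intro x
    by_cases hxA : x ∈ A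
    swap
    · exact ⟨∅, fun h => absurd h hxA⟩
    obtain ⟨W, hW, i, hWi⟩ : ∃ W ∈ 𝓝 x, ∃ i, C ∩ W ⊆ U i := by
      by_cases hxC : x ∈ C
      · obtain ⟨i, hi⟩ := mem_iUnion.mp (hCU hxC)
        exact ⟨U i, (hUo i).mem_nhds hi, i, inter_subset_right⟩
      · exact ⟨Cᶜ, hC.isOpen_compl.mem_nhds hxC, i₀, by simp⟩
    obtain ⟨V, hV, hxV, hVs⟩ := hz.mem_nhds_iff.mp
      (inter_mem (inter_mem hW (hA.isOpen.mem_nhds hxA))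
        (Metric.eball_mem_nhds x (ENNReal.half_pos hε.ne')))
    refine ⟨V, fun _ => ⟨hV, hxV, fun y hy => (hVs hy).1.2, ?_, i,
      fun y hy => hWi ⟨hy.1, (hVs hy.2).1.1⟩⟩⟩
    refine (Metric.ediam_mono fun y hy => (hVs hy).2).trans ?_
    refine Metric.ediam_eball_le.trans ?_
    rw [ENNReal.mul_div_cancel (by simp) (by simp)]
  choose V hV using key
  obtain ⟨t, htA, htc, hAt⟩ := countable_cover_nhdsWithin (f := V) (s := A)
    fun x hx => mem_nhdsWithin_of_mem_nhds ((hV x hx).1.isOpen.mem_nhds (hV x hx).2.1)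
  have htne : t.Nonempty := by
    obtain ⟨y, hy, -⟩ := mem_iUnion₂.mp (hAt (hCA hx₀))
    exact ⟨y, hy⟩
  obtain ⟨u, rfl⟩ := htc.exists_eq_range htne
  have hu : ∀ n, u n ∈ A := fun n => htA ⟨n, rfl⟩
  replace hV := fun n => hV (u n) (hu n)
  have hsub : ∀ n, disjointed (fun n => V (u n)) n ⊆ V (u n) := fun n => disjointed_le _ n
  have hUn : ⋃ n, disjointed (fun n => V (u n)) n = A := by
    rw [iUnion_disjointed]
    refine subset_antisymm (iUnion_subset fun n => (hV n).2.2.1) fun x hx => ?_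
    simpa using hAt hx
  refine IsClopenPartition.exists_of_infinite (d := disjointed fun n => V (u n)) (fun n => ?_)
    (fun n => (Metric.ediam_mono (hsub n)).trans (hV n).2.2.2.1) (disjoint_disjointed _) hUn ?_
  · exact disjointedRec (fun _ i h => h.diff (hV i).1) (hV n).1
  · intro hf
    choose i hi using fun n => (hV n).2.2.2.2
    classical
    refine hfin (hf.toFinset.image i) fun x hx => ?_
    obtain ⟨n, hn⟩ := mem_iUnion.mp (hUn.ge (hCA hx))
    refine mem_iUnion₂.mpr ⟨i n, ?_, hi n ⟨hx, hsub n hn⟩⟩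
    exact Finset.mem_image_of_mem _ (hf.mem_toFinset.mpr ⟨x, hx, hn⟩)

theorem exists_bijective_of_forall_infinite (r : ℕ → ℕ → Prop) (h₁ : ∀ i, {k | r i k}.Infinite)
    (h₂ : ∀ k, {i | r i k}.Infinite) : ∃ σ : ℕ → ℕ, Function.Bijective σ ∧ ∀ i, r i (σ i) := by
  obtain ⟨f, hf, hrf⟩ := extraction_forall_of_frequently
    fun i => Nat.frequently_atTop_iff_infinite.mpr (h₁ i)
  obtain ⟨g, hg, hrg⟩ := extraction_forall_of_frequently
    fun k => Nat.frequently_atTop_iff_infinite.mpr (h₂ k)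
  exact Function.Embedding.schroeder_bernstein_of_rel hf.injective hg.injective r hrf hrg

theorem IsClopenPartition.finite_inter_of_isCompact {X : Type*} [PseudoEMetricSpace X]
    {a : ℕ → Set X} {A T : Set X} {ε : ENNReal} (h : IsClopenPartition a A ε) (hA : IsClosed A)
    (hT : IsCompact T) : {i | (T ∩ a i).Nonempty}.Finite := by
  obtain ⟨s, hs⟩ := (hT.inter_right hA).elim_finite_subcover a (fun i => (h.isClopen i).isOpen)
    (inter_subset_right.trans h.iUnion_eq.ge)
  refine s.finite_toSet.subset fun i ⟨x, hxT, hxi⟩ => ?_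
  obtain ⟨k, hk, hxk⟩ := mem_iUnion₂.mp
    (hs ⟨hxT, h.iUnion_eq.le (mem_iUnion_of_mem i hxi)⟩)
  by_contra hne
  have hik : i ≠ k := fun e => hne (e ▸ hk)
  exact (h.disjoint hik).notMem_of_mem_left hxi hxk

/-- The splitting step: compatible clopen sets have compatible clopen partitions. -/
theorem exists_compatible_partitions {X : Type*} [PseudoEMetricSpace X]
    [SecondCountableTopology X]
    (hz : IsTopologicalBasis {s : Set X | IsClopen s}) {T D : ℕ → Set X}
    (hT : ∀ j, IsCompact (T j)) (hTm : Monotone T) (hD : ∀ j, IsClosed (D j)) (hDm : Monotone D)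
    (hdense : ∀ U, IsOpen U → U.Nonempty → ∃ j, (D j ∩ U).Nonempty)
    (hnc : ∀ j B, IsClopen B → (D j ∩ B).Nonempty → ¬ IsCompact (D j ∩ B))
    {A B : Set X} (hA : IsClopen A) (hB : IsClopen B) (hAne : A.Nonempty) (hBne : B.Nonempty)
    (hAB : ∀ j, (T j ∩ A).Nonempty → (D j ∩ B).Nonempty) {ε : ENNReal} (hε : 0 < ε) :
    ∃ a b : ℕ → Set X, IsClopenPartition a A ε ∧ IsClopenPartition b B ε ∧
      ∀ i j, (T j ∩ a i).Nonempty → (D j ∩ b i).Nonempty := by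
  have hAnc : ¬ IsCompact A := fun h => by
    obtain ⟨j, hj⟩ := hdense A hA.isOpen hAne
    exact hnc j A hA hj (h.inter_left (hD j))
  obtain ⟨a, ha, -⟩ :=
    exists_isClopenPartition_infinite hz hA hA.isClosed subset_rfl hAnc hε
  obtain ⟨m, hmB, hm⟩ : ∃ m, (D m ∩ B).Nonempty ∧ ∀ j, (T j ∩ A).Nonempty → m ≤ j := by
    classical
    by_cases h : ∃ j, (T j ∩ A).Nonempty
    · exact ⟨Nat.find h, hAB _ (Nat.find_spec h), fun j hj => Nat.find_min' h hj⟩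
    · obtain ⟨m, hm⟩ := hdense B hB.isOpen hBne
      exact ⟨m, hm, fun j hj => absurd ⟨j, hj⟩ h⟩
  obtain ⟨b, hb, hbinf⟩ := exists_isClopenPartition_infinite hz hB ((hD m).inter hB.isClosed)
    inter_subset_right (hnc m B hB hmB) hε
  refine (exists_bijective_of_forall_infinite
    (fun i k => ∀ j, (T j ∩ a i).Nonempty → (D j ∩ b k).Nonempty)
    (fun i => ?_) fun k => ?_).elim fun σ ⟨hσ, hr⟩ => ⟨a, b ∘ σ, ha, hb.comp_bijective hσ, hr⟩
  · refine hbinf.mono fun k hk j hj => ?_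
    have hmj : m ≤ j := hm j (hj.mono (inter_subset_inter_right _
      ((subset_iUnion a i).trans ha.iUnion_eq.le)))
    exact hk.mono (inter_subset_inter_left _ (inter_subset_left.trans (hDm hmj)))
  · obtain ⟨l, hl⟩ := hdense (b k) (hb.isClopen k).isOpen (hb.nonempty k)
    refine (ha.finite_inter_of_isCompact hA.isClosed (hT l)).infinite_compl.mono
      fun i hi j hj => ?_
    have hlj : l ≤ j := by
      by_contra! hjl
      exact hi (hj.mono (inter_subset_inter_left _ (hTm hjl.le)))
    exact hl.mono (inter_subset_inter_left _ (hDm hlj))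

section Scheme

variable {X : Type*} [MetricSpace X] {A : List ℕ → Set X} {ε : ℕ → ENNReal}

theorem vanishingDiam_of_isClopenPartition
    (h : ∀ l, IsClopenPartition (fun i => A (i :: l)) (A l) (ε l.length))
    (hε : Tendsto ε atTop (𝓝 0)) : CantorScheme.VanishingDiam A := fun z => by
  rw [← tendsto_add_atTop_iff_nat 1]
  refine tendsto_of_tendsto_of_tendsto_of_le_of_le tendsto_const_nhds hε (fun _ => zero_le)
    fun n => ?_
  simpa using (h (res z n)).ediam_le (z n)

theorem res_eq_of_mem_isClopenPartition
    (h : ∀ l, IsClopenPartition (fun i => A (i :: l)) (A l) (ε l.length)) {y : X} {z w : ℕ → ℕ}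
    (n : ℕ) (hz : y ∈ A (res z n)) (hw : y ∈ A (res w n)) : res z n = res w n := by
  induction n with
  | zero => simp
  | succ n ih =>
    rw [res_succ] at hz hw
    have hsub : ∀ l i, A (i :: l) ⊆ A l := fun l i =>
      (subset_iUnion (fun i => A (i :: l)) i).trans (h l).iUnion_eq.le
    have e := ih (hsub _ _ hz) (hsub _ _ hw)
    rw [res_succ, res_succ, e]
    congr 1
    by_contra hne
    rw [e] at hz
    exact ((h _).disjoint hne).notMem_of_mem_left hz hw

theorem exists_branch_of_isClopenPartition (h₀ : A [] = univ)
    (h : ∀ l, IsClopenPartition (fun i => A (i :: l)) (A l) (ε l.length)) (y : X) :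
    ∃ z : ℕ → ℕ, ∀ n, y ∈ A (res z n) := by
  have hnext : ∀ l, ∃ i, y ∈ A l → y ∈ A (i :: l) := fun l => by
    by_cases hy : y ∈ A l
    · obtain ⟨i, hi⟩ := mem_iUnion.mp ((h l).iUnion_eq.ge hy)
      exact ⟨i, fun _ => hi⟩
    · exact ⟨0, fun h => absurd h hy⟩
  choose next hnext using hnext
  let L : ℕ → List ℕ := fun n => Nat.rec [] (fun _ l => next l :: l) n
  have hres : ∀ n, res (fun n => next (L n)) n = L n := fun n => by
    induction n with
    | zero => rfl
    | succ n ih => rw [res_succ, ih]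
  refine ⟨fun n => next (L n), fun n => ?_⟩
  rw [hres]
  induction n with
  | zero => exact h₀ ▸ mem_univ y
  | succ n ih => exact hnext _ ih

theorem exists_homeomorph_of_isClopenPartition [CompleteSpace X] (h₀ : A [] = univ)
    (h : ∀ l, IsClopenPartition (fun i => A (i :: l)) (A l) (ε l.length))
    (hε : Tendsto ε atTop (𝓝 0)) :
    ∃ f : (ℕ → ℕ) ≃ₜ X, ∀ z n, f z ∈ A (res z n) := by
  have hdiam := vanishingDiam_of_isClopenPartition h hε
  have hne : ∀ l, (A l).Nonempty := fun l =>
    ((h l).nonempty 0).mono ((subset_iUnion (fun i => A (i :: l)) 0).trans (h l).iUnion_eq.le)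
  have hclosed : ∀ l, IsClosed (A l) ∧ IsOpen (A l)
    | [] => by simp [h₀]
    | i :: l => (h l).isClopen i
  have hanti : CantorScheme.ClosureAntitone A := CantorScheme.Antitone.closureAntitone
    (fun l i => (subset_iUnion (fun i => A (i :: l)) i).trans (h l).iUnion_eq.le)
    fun l => (hclosed l).1
  have hdom := hanti.map_of_vanishingDiam hdiam hne
  let F : (ℕ → ℕ) → X := fun z => (CantorScheme.inducedMap A).2 ⟨z, hdom ▸ mem_univ z⟩
  have hF : ∀ z n, F z ∈ A (res z n) := fun z n => CantorScheme.map_mem _ n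
  have hcont : Continuous F := hdiam.map_continuous.comp (by fun_prop)
  have heq : ∀ y z, (∀ n, y ∈ A (res z n)) → F z = y := fun y z hy => by
    refine eq_of_forall_dist_le fun δ hδ => ?_
    obtain ⟨n, hn⟩ := hdiam.dist_lt δ hδ z
    exact (hn _ (hF z n) _ (hy n)).le
  have hbij : Function.Bijective F := by
    refine ⟨fun z w hzw => res_injective (funext fun n => ?_), fun y => ?_⟩
    · exact res_eq_of_mem_isClopenPartition h n (hF z n) (hzw ▸ hF w n)
    · obtain ⟨z, hz⟩ := exists_branch_of_isClopenPartition h₀ h y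
      exact ⟨z, heq y z hz⟩
  have hopen : IsOpenMap F := by
    rw [(isTopologicalBasis_cylinders fun _ : ℕ => ℕ).isOpenMap_iff]
    rintro _ ⟨z, n, rfl⟩
    convert (hclosed (res z n)).2
    ext y
    rw [cylinder_eq_res]
    refine ⟨?_, fun hy => ?_⟩
    · rintro ⟨w, hw, rfl⟩
      have hw : res w n = res z n := hw
      exact hw ▸ hF w n
    · obtain ⟨w, rfl⟩ := hbij.surjective y
      exact ⟨w, res_eq_of_mem_isClopenPartition h n (hF w n) hy, rfl⟩
  exact ⟨(Equiv.ofBijective F hbij).toHomeomorphOfContinuousOpen hcont hopen, hF⟩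

end Scheme

theorem exists_homeomorph_image_subset_of_monotone {X : Type*} [TopologicalSpace X] [PolishSpace X]
    (hz : IsTopologicalBasis {s : Set X | IsClopen s}) {T D : ℕ → Set X}
    (hT : ∀ j, IsCompact (T j)) (hTm : Monotone T) (hD : ∀ j, IsClosed (D j)) (hDm : Monotone D)
    (hDne : ∀ j, (D j).Nonempty)
    (hdense : ∀ U, IsOpen U → U.Nonempty → ∃ j, (D j ∩ U).Nonempty)
    (hnc : ∀ j B, IsClopen B → (D j ∩ B).Nonempty → ¬ IsCompact (D j ∩ B)) :
    ∃ g : X ≃ₜ X, ∀ j, g '' T j ⊆ D j := by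
  let := TopologicalSpace.upgradeIsCompletelyMetrizable X
  let P : Set X × Set X → Prop := fun p => IsClopen p.1 ∧ IsClopen p.2 ∧ p.1.Nonempty ∧
    p.2.Nonempty ∧ ∀ j, (T j ∩ p.1).Nonempty → (D j ∩ p.2).Nonempty
  have hstep : ∀ (n : ℕ) (p : {p // P p}), ∃ c : ℕ → {p // P p},
      IsClopenPartition (fun i => (c i).1.1) p.1.1 (2⁻¹ ^ n) ∧
      IsClopenPartition (fun i => (c i).1.2) p.1.2 (2⁻¹ ^ n) := by
    rintro n ⟨⟨A, B⟩, hA, hB, hAne, hBne, hAB⟩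
    obtain ⟨a, b, ha, hb, hab⟩ := exists_compatible_partitions hz hT hTm hD hDm hdense hnc
      hA hB hAne hBne hAB (ε := 2⁻¹ ^ n) (ENNReal.pow_pos (by simp) n)
    exact ⟨fun i => ⟨(a i, b i), ha.isClopen i, hb.isClopen i, ha.nonempty i, hb.nonempty i,
      hab i⟩, ha, hb⟩
  choose c hcA hcB using hstep
  obtain ⟨x, -⟩ := hDne 0
  let S : List ℕ → {p // P p} := fun l => List.rec
    ⟨(univ, univ), isClopen_univ, isClopen_univ, ⟨x, trivial⟩, ⟨x, trivial⟩,
      fun j _ => by simpa using hDne j⟩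
    (fun i l p => c l.length p i) l
  have hε : Tendsto (fun n : ℕ => (2⁻¹ : ENNReal) ^ n) atTop (𝓝 0) :=
    ENNReal.tendsto_pow_atTop_nhds_zero_of_lt_one (by simp)
  obtain ⟨fA, hfA⟩ := exists_homeomorph_of_isClopenPartition (A := fun l => (S l).1.1) rfl
    (fun l => hcA l.length (S l)) hε
  obtain ⟨fB, hfB⟩ := exists_homeomorph_of_isClopenPartition (A := fun l => (S l).1.2) rfl
    (fun l => hcB l.length (S l)) hε
  refine ⟨fA.symm.trans fB, fun j => ?_⟩
  rintro _ ⟨y, hy, rfl⟩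
  obtain ⟨z, rfl⟩ := fA.surjective y
  simp only [Homeomorph.trans_apply, Homeomorph.symm_apply_apply]
  rw [← (hD j).closure_eq, Metric.mem_closure_iff]
  intro δ hδ
  obtain ⟨n, hn⟩ := (vanishingDiam_of_isClopenPartition (A := fun l => (S l).1.2)
    (fun l => hcB l.length (S l)) hε).dist_lt δ hδ z
  obtain ⟨w, hwD, hwB⟩ := (S (res z n)).2.2.2.2.2 j ⟨_, hy, hfA z n⟩
  exact ⟨w, hwD, hn _ (hfB z n) _ hwB⟩

theorem exists_homeomorph_image_subset {X : Type*} [TopologicalSpace X] [PolishSpace X]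
    (hz : IsTopologicalBasis {s : Set X | IsClopen s}) {T D : ℕ → Set X}
    (hT : ∀ j, IsCompact (T j)) (hD : ∀ j, IsClosed (D j)) (hDm : Monotone D)
    (hDne : ∀ j, (D j).Nonempty)
    (hdense : ∀ U, IsOpen U → U.Nonempty → ∃ j, (D j ∩ U).Nonempty)
    (hnc : ∀ j B, IsClopen B → (D j ∩ B).Nonempty → ¬ IsCompact (D j ∩ B)) :
    ∃ g : X ≃ₜ X, ∀ j, g '' T j ⊆ D j := by
  obtain ⟨g, hg⟩ := exists_homeomorph_image_subset_of_monotone hz (isCompact_accumulate hT)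
    monotone_accumulate hD hDm hDne hdense hnc
  exact ⟨g, fun j => (image_mono subset_accumulate).trans (hg j)⟩

theorem infinite_setOf_odd_ge (j : ℕ) : {n | ∃ k ≥ j, n = 2 * k + 1}.Infinite :=
  infinite_of_forall_exists_gt fun n =>
    ⟨2 * (n + j) + 1, ⟨n + j, by omega, rfl⟩, by omega⟩

section Pi

variable {K : Type*} [NontriviallyNormedField K]

theorem isTopologicalBasis_isClopen_pi [IsUltrametricDist K] :
    IsTopologicalBasis {s : Set (ℕ → K) | IsClopen s} := by
  refine isTopologicalBasis_of_isOpen_of_nhds (fun s hs => hs.isOpen) fun x U hx hU => ?_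
  obtain ⟨I, u, hu, hIU⟩ := isOpen_pi_iff.mp hU x hx
  have key : ∀ i, ∃ r : ℝ, i ∈ I → 0 < r ∧ Metric.ball (x i) r ⊆ u i := fun i => by
    by_cases hi : i ∈ I
    · obtain ⟨r, hr, h⟩ := Metric.isOpen_iff.mp (hu i hi).1 _ (hu i hi).2
      exact ⟨r, fun _ => ⟨hr, h⟩⟩
    · exact ⟨0, fun h => absurd h hi⟩
  choose r hr using key
  refine ⟨(I : Set ℕ).pi fun i => Metric.ball (x i) (r i), ⟨?_, ?_⟩, ?_, ?_⟩
  · exact isClosed_set_pi fun i _ => IsUltrametricDist.isClosed_ball _ _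
  · exact isOpen_set_pi I.finite_toSet fun i _ => Metric.isOpen_ball
  · exact fun i hi => Metric.mem_ball_self (hr i hi).1
  · exact (pi_mono fun i hi => (hr i hi).2).trans hIU

theorem exists_homeomorph_infinitelyDeficientPi [IsUltrametricDist K] [PolishSpace K]
    {T : ℕ → Set (ℕ → K)} (hT : ∀ j, IsCompact (T j)) :
    ∃ g : (ℕ → K) ≃ₜ (ℕ → K), ∀ j, InfinitelyDeficientPi (g '' T j) := by
  refine (exists_homeomorph_image_subset isTopologicalBasis_isClopen_pi hT
    (D := fun j => {x | ∀ k ≥ j, x (2 * k + 1) = 0}) (fun j => ?_)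
    (fun i j hij x hx k hk => hx k (hij.trans hk)) (fun j => ⟨0, fun _ _ => rfl⟩) ?_ ?_).imp
    fun g hg j => ⟨_, infinite_setOf_odd_ge j,
      fun _ ⟨k, hk, hn⟩ => ⟨0, fun x hx => hn ▸ hg j hx k hk⟩⟩
  · simp only [ofPred_forall]
    exact isClosed_iInter fun k => isClosed_iInter fun _ =>
      isClosed_eq (continuous_apply _) continuous_const
  · rintro U hU ⟨x, hx⟩
    obtain ⟨I, u, hu, hIU⟩ := isOpen_pi_iff.mp hU x hx
    refine ⟨I.sup id + 1, fun i => if i ∈ I then x i else 0, fun k hk => if_neg fun hkI => ?_,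
      hIU fun i hi => ?_⟩
    · have := Finset.le_sup (f := id) hkI
      simp only [id] at this
      omega
    · rw [if_pos (Finset.mem_coe.mp hi)]
      exact (hu i hi).2
  · rintro j B hB ⟨x, hxD, hxB⟩ hcomp
    obtain ⟨I, u, hu, hIU⟩ := isOpen_pi_iff.mp hB.isOpen x hxB
    have hI : 2 * (I.sup id + 1) ∉ I := fun h => by
      have := Finset.le_sup (f := id) h
      simp only [id] at this
      omega
    refine noncompact_univ K ?_
    convert hcomp.image (continuous_apply (2 * (I.sup id + 1)))
    refine (eq_univ_of_forall fun t => ?_).symm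
    refine ⟨Function.update x (2 * (I.sup id + 1)) t, ⟨fun k hk => ?_, hIU fun i hi => ?_⟩,
      Function.update_self ..⟩
    · rw [Function.update_of_ne (by omega)]
      exact hxD k hk
    · rw [Function.update_of_ne (by rintro rfl; exact hI hi)]
      exact (hu i hi).2

end Pi

section ZeroAtInfty

variable {K : Type*} [NontriviallyNormedField K]

theorem ZeroAtInftyContinuousMap.dist_le_iff {f g : C₀(ℕ, K)} {r : ℝ} :
    dist f g ≤ r ↔ ∀ n, dist (f n) (g n) ≤ r := by
  rw [← dist_toBCF_eq_dist]
  exact BoundedContinuousFunction.dist_le_iff_of_nonempty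

theorem ZeroAtInftyContinuousMap.dist_apply_le (f g : C₀(ℕ, K)) (n : ℕ) :
    dist (f n) (g n) ≤ dist f g :=
  dist_le_iff.mp le_rfl n

theorem ZeroAtInftyContinuousMap.continuous_eval (n : ℕ) : Continuous fun f : C₀(ℕ, K) => f n :=
  (LipschitzWith.mk_one fun f g => dist_apply_le f g n).continuous

theorem ZeroAtInftyContinuousMap.isUltrametricDist_s11 [IsUltrametricDist K] :
    IsUltrametricDist C₀(ℕ, K) where
  dist_triangle_max f g h := dist_le_iff.mpr fun n =>
    (IsUltrametricDist.dist_triangle_max (f n) (g n) (h n)).trans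
      (max_le_max (dist_apply_le f g n) (dist_apply_le g h n))

/-- The `n`-th unit vector of `c₀`. -/
noncomputable def ZeroAtInftyContinuousMap.unitVector (K : Type*) [NontriviallyNormedField K]
    (n : ℕ) : C₀(ℕ, K) where
  toFun := Pi.single n 1
  continuous_toFun := continuous_of_discreteTopology
  zero_at_infty' := by
    rw [cocompact_eq_cofinite]
    refine tendsto_nhds_of_eventually_eq ?_
    filter_upwards [(finite_singleton n).compl_mem_cofinite] with m hm
    exact Pi.single_eq_of_ne hm 1

theorem ZeroAtInftyContinuousMap.unitVector_apply (n m : ℕ) :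
    unitVector K n m = (Pi.single n 1 : ℕ → K) m := rfl

/-- The first `N` terms of a null sequence. -/
noncomputable def ZeroAtInftyContinuousMap.truncation (f : C₀(ℕ, K)) (N : ℕ) : C₀(ℕ, K) :=
  ∑ n ∈ Finset.range N, f n • unitVector K n

theorem ZeroAtInftyContinuousMap.truncation_apply (f : C₀(ℕ, K)) (N m : ℕ) :
    f.truncation N m = if m < N then f m else 0 := by
  induction N with
  | zero => simp [truncation]
  | succ N ih =>
    have : f.truncation (N + 1) = f.truncation N + f N • unitVector K N :=
      Finset.sum_range_succ _ _
    rw [this, add_apply, ih, smul_apply, unitVector_apply, Pi.single_apply]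
    rcases lt_trichotomy m N with h | rfl | h
    · simp [h, h.ne, h.trans (Nat.lt_succ_self N)]
    · simp
    · simp [h.not_gt, h.ne', show ¬ m < N + 1 by omega]

theorem ZeroAtInftyContinuousMap.tendsto_truncation (f : C₀(ℕ, K)) :
    Tendsto f.truncation atTop (𝓝 f) := by
  rw [Metric.tendsto_atTop]
  intro ε hε
  have hf := f.zero_at_infty'
  rw [cocompact_eq_cofinite, Nat.cofinite_eq_atTop] at hf
  obtain ⟨N, hN⟩ := Metric.tendsto_atTop.mp hf (ε / 2) (half_pos hε)
  refine ⟨N, fun n hn => lt_of_le_of_lt (dist_le_iff.mpr fun m => ?_) (half_lt_self hε)⟩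
  rw [truncation_apply]
  split_ifs with h
  · simpa using (half_pos hε).le
  · rw [dist_comm]
    exact (hN m (by omega)).le

theorem ZeroAtInftyContinuousMap.separableSpace [SeparableSpace K] :
    SeparableSpace C₀(ℕ, K) := by
  rw [← isSeparable_univ_iff]
  refine ((countable_range (unitVector K)).isSeparable.span (R := K)).closure.mono fun f _ => ?_
  exact mem_closure_of_tendsto f.tendsto_truncation (Eventually.of_forall fun N =>
    Submodule.sum_mem _ fun n _ => Submodule.smul_mem _ _
      (Submodule.subset_span (mem_range_self n)))

theorem exists_homeomorph_infinitelyDeficientC0 [IsUltrametricDist K] [CompleteSpace K]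
    [SeparableSpace K] {T : ℕ → Set C₀(ℕ, K)} (hT : ∀ j, IsCompact (T j)) :
    ∃ g : C₀(ℕ, K) ≃ₜ C₀(ℕ, K), ∀ j, InfinitelyDeficientC0 (g '' T j) := by
  have := ZeroAtInftyContinuousMap.separableSpace (K := K)
  have := ZeroAtInftyContinuousMap.isUltrametricDist_s11 (K := K)
  have : SecondCountableTopology C₀(ℕ, K) := UniformSpace.secondCountable_of_separable _
  have hz : IsTopologicalBasis {s : Set C₀(ℕ, K) | IsClopen s} := by
    refine isTopologicalBasis_of_isOpen_of_nhds (fun s hs => hs.isOpen) fun x U hx hU => ?_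
    obtain ⟨r, hr, h⟩ := Metric.isOpen_iff.mp hU x hx
    exact ⟨Metric.ball x r, IsUltrametricDist.isClopen_ball x r, Metric.mem_ball_self hr, h⟩
  refine (exists_homeomorph_image_subset hz hT
    (D := fun j => {x | ∀ k ≥ j, x (2 * k + 1) = 0}) (fun j => ?_)
    (fun i j hij x hx k hk => hx k (hij.trans hk)) (fun j => ⟨0, fun _ _ => rfl⟩) ?_ ?_).imp
    fun g hg j => ⟨_, infinite_setOf_odd_ge j,
      fun _ ⟨k, hk, hn⟩ => ⟨0, fun x hx => hn ▸ hg j hx k hk⟩⟩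
  · simp only [ofPred_forall]
    exact isClosed_iInter fun k => isClosed_iInter fun _ =>
      isClosed_eq (ZeroAtInftyContinuousMap.continuous_eval _) continuous_const
  · rintro U hU ⟨x, hx⟩
    obtain ⟨N, hN⟩ := (x.tendsto_truncation.eventually (hU.mem_nhds hx)).exists
    refine ⟨N, x.truncation N, fun k hk => ?_, hN⟩
    rw [ZeroAtInftyContinuousMap.truncation_apply, if_neg (by omega)]
  · rintro j B hB ⟨x, hxD, hxB⟩ hcomp
    obtain ⟨r, hr, hrB⟩ := Metric.isOpen_iff.mp hB.isOpen x hxB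
    obtain ⟨c, hc0, hcr⟩ := NormedField.exists_norm_lt K hr
    let y : ℕ → C₀(ℕ, K) := fun k => x + c • ZeroAtInftyContinuousMap.unitVector K (2 * k)
    have hy : ∀ k m, y k m = x m + c * (Pi.single (2 * k) 1 : ℕ → K) m := fun k m => rfl
    have hymem : ∀ k, y k ∈ {x : C₀(ℕ, K) | ∀ k ≥ j, x (2 * k + 1) = 0} ∩ B := fun k => by
      refine ⟨fun i hi => ?_, hrB (lt_of_le_of_lt ?_ hcr)⟩
      · rw [hy, hxD i hi, Pi.single_eq_of_ne (by omega)]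
        simp
      · refine ZeroAtInftyContinuousMap.dist_le_iff.mpr fun m => ?_
        rw [hy, Pi.single_apply]
        split_ifs <;> simp
    have hydist : ∀ k l, k ≠ l → ‖c‖ ≤ dist (y k) (y l) := fun k l hkl => by
      refine le_trans (le_of_eq ?_) (ZeroAtInftyContinuousMap.dist_apply_le _ _ (2 * k))
      rw [hy, hy, Pi.single_eq_same, Pi.single_eq_of_ne (by omega)]
      simp
    obtain ⟨z, -, φ, hφ, hlim⟩ := hcomp.tendsto_subseq hymem
    obtain ⟨N, hN⟩ := Metric.cauchySeq_iff.mp hlim.cauchySeq ‖c‖ hc0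
    exact (hN N le_rfl (N + 1) (Nat.le_succ N)).not_ge
      (hydist _ _ (hφ.injective.ne (Nat.succ_ne_self N).symm))

end ZeroAtInfty

end

/-- Let `K` be a locally compact field with a complete
non-Archimedean multiplicative norm whose value group is nontrivial.  Let `X` be either
`K^ℕ` with the Tychonoff product topology or `c₀(ℕ, K)` with its norm topology, and let
`{T_j : j ∈ ℕ}` be a countable family of compact subsets of `X`.  Then there is a
homeomorphism `g` of `X` onto itself such that `g(T_j)` is infinitely deficient for
every `j`. -/
theorem exists_homeomorph_infinitely_deficient (K : Type*) [NontriviallyNormedField K]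
    [IsUltrametricDist K] [CompleteSpace K] [LocallyCompactSpace K] :
    (∀ T : ℕ → Set (ℕ → K), (∀ j, IsCompact (T j)) →
      ∃ g : (ℕ → K) ≃ₜ (ℕ → K), ∀ j, InfinitelyDeficientPi (g '' T j)) ∧
    (∀ T : ℕ → Set C₀(ℕ, K), (∀ j, IsCompact (T j)) →
      ∃ g : C₀(ℕ, K) ≃ₜ C₀(ℕ, K), ∀ j, InfinitelyDeficientC0 (g '' T j)) := by
  have : ProperSpace K := .of_locallyCompactSpace K
  exact ⟨fun _ hT => exists_homeomorph_infinitelyDeficientPi hT,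
    fun _ hT => exists_homeomorph_infinitelyDeficientC0 hT⟩
end
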